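/- Define V(γ) = ∫_γ^∞ x² p(x) dx − (∫_γ^∞ x p(x) dx)²/(∫_γ^∞ p(x) dx) for γ ≥ 0. Fix s ∈ (0,1) and consider pairs (γ₁,γ₂) with γ₁, γ₂ ≥ 0 and ∫_{γ₁}^∞ p + ∫_{γ₂}^∞ p = s. Among all such pairs, the sum V(γ₁) + V(γ₂) is minimized at the symmetric pair γ₁ = γ₂: if γ* ≥ 0 satisfies 2∫_{γ*}^∞ p = s, then for every admissible pair (γ₁,γ₂), V(γ*) + V(γ*) ≤ V(γ₁) + V(γ₂). (Core minimization in the proof of Proposition 1, using evenness of p to write both tails on the positive half-line.) -/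

import Mathlib

open MeasureTheory Set

/-- Four-point form of log-concavity: moving two points inwards by the same amount
does not decrease the product of the values. -/
lemma mul_le_mul_of_log_concave {p : ℝ → ℝ} (hpos : ∀ x, 0 < p x)
    (hlogconcave : ∀ x y θ : ℝ, 0 ≤ θ → θ ≤ 1 →
      p x ^ θ * p y ^ (1 - θ) ≤ p (θ * x + (1 - θ) * y))
    (a : ℝ) {s t : ℝ} (hs : 0 ≤ s) (ht : 0 ≤ t) :
    p a * p (a + s + t) ≤ p (a + s) * p (a + t) := by
  rcases eq_or_lt_of_le (add_nonneg hs ht) with h0 | h0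
  · obtain rfl : s = 0 := by linarith
    obtain rfl : t = 0 := by linarith
    simp
  have key : ∀ u v : ℝ, 0 ≤ u → 0 ≤ v → u + v = s + t →
      p a ^ (v / (s + t)) * p (a + s + t) ^ (u / (s + t)) ≤ p (a + u) := by
    intro u v hu hv huv
    have h := hlogconcave a (a + s + t) (v / (s + t)) (by positivity)
      ((div_le_one h0).2 (by linarith))
    have e1 : 1 - v / (s + t) = u / (s + t) := by field_simp; linarith
    have e2 : v / (s + t) * a + u / (s + t) * (a + s + t) = a + u := by
      rw [← e1]; field_simp; linear_combination (-(s + t)) * huv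
    rwa [e1, e2] at h
  have h1 := key s t hs ht rfl
  have h2 := key t s ht hs (add_comm _ _)
  have hsum : s / (s + t) + t / (s + t) = 1 := by field_simp
  have hx : ∀ x, p x ^ (s / (s + t)) * p x ^ (t / (s + t)) = p x := fun x ↦ by
    rw [← Real.rpow_add (hpos x), hsum, Real.rpow_one]
  calc p a * p (a + s + t)
      = (p a ^ (t / (s + t)) * p (a + s + t) ^ (s / (s + t))) *
        (p a ^ (s / (s + t)) * p (a + s + t) ^ (t / (s + t))) := by
        conv_lhs => rw [← hx a, ← hx (a + s + t)]
        ring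
    _ ≤ p (a + s) * p (a + t) :=
        mul_le_mul h1 h2 (mul_nonneg (Real.rpow_nonneg (hpos _).le _)
          (Real.rpow_nonneg (hpos _).le _)) (hpos _).le

/-- Tail integrals of a positive integrable function are positive. -/
lemma setIntegral_Ioi_pos {p : ℝ → ℝ} (hpos : ∀ x, 0 < p x) (hp : Integrable p) (c : ℝ) :
    0 < ∫ x in Ioi c, p x := by
  rw [setIntegral_pos_iff_support_of_nonneg_ae (Filter.Eventually.of_forall fun x ↦ (hpos x).le)
    hp.integrableOn]
  have : Function.support p = univ := by ext x; simp [(hpos x).ne']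
  simp [this]

/-- A tail integral as a constant minus a primitive. -/
lemma setIntegral_Ioi_eq_sub {f : ℝ → ℝ} (hf : Integrable f) (c : ℝ) :
    ∫ x in Ioi c, f x = (∫ x in Ioi 0, f x) - ∫ x in (0 : ℝ)..c, f x := by
  rw [← intervalIntegral.integral_interval_add_Ioi (a := 0) (b := c) hf.integrableOn
    hf.integrableOn]
  ring

lemma continuous_setIntegral_Ioi {f : ℝ → ℝ} (hf : Integrable f) :
    Continuous fun c ↦ ∫ x in Ioi c, f x := by
  rw [funext (setIntegral_Ioi_eq_sub hf)]
  exact continuous_const.sub (intervalIntegral.continuous_primitive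
    (fun a b ↦ hf.intervalIntegrable) 0)

lemma hasDerivAt_setIntegral_Ioi {f : ℝ → ℝ} (hf : Integrable f)
    {c : ℝ} (hc : ContinuousAt f c) :
    HasDerivAt (fun c ↦ ∫ x in Ioi c, f x) (-f c) c := by
  rw [funext (setIntegral_Ioi_eq_sub hf)]
  simpa using (intervalIntegral.integral_hasDerivAt_right hf.intervalIntegrable
    hf.aestronglyMeasurable.stronglyMeasurableAtFilter hc).const_sub (∫ x in Ioi 0, f x)

/-- The mean residual life of a positive log-concave density is nonincreasing. -/
lemma mean_residual_antitone {p : ℝ → ℝ} (hpos : ∀ x, 0 < p x)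
    (hlogconcave : ∀ x y θ : ℝ, 0 ≤ θ → θ ≤ 1 →
      p x ^ θ * p y ^ (1 - θ) ≤ p (θ * x + (1 - θ) * y))
    (hp : Integrable p) (hxp : Integrable fun x ↦ x * p x) :
    Antitone fun c ↦ (∫ x in Ioi c, x * p x) / (∫ x in Ioi c, p x) - c := by
  intro c d hcd
  have hSc := setIntegral_Ioi_pos hpos hp c
  have hSd := setIntegral_Ioi_pos hpos hp d
  set a := (∫ x in Ioi c, x * p x) / (∫ x in Ioi c, p x) - c with ha
  have hshift : ∀ f : ℝ → ℝ, ∫ x in Ioi d, f x = ∫ x in Ioi c, f (x + (d - c)) := fun f ↦ by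
    rw [← (measurePreserving_add_right volume (d - c)).setIntegral_preimage_emb
      (measurableEmbedding_addRight (d - c)) f (Ioi d)]
    simp
  have hlin : ∀ b : ℝ, Integrable fun x ↦ (x - b) * p x := fun b ↦ by
    simp_rw [sub_mul]
    exact hxp.sub (hp.const_mul b)
  have hlin_eq : ∀ b e : ℝ, ∫ x in Ioi e, (x - b) * p x =
      (∫ x in Ioi e, x * p x) - b * ∫ x in Ioi e, p x := fun b e ↦ by
    simp_rw [sub_mul]
    rw [integral_sub hxp.integrableOn (hp.const_mul b).integrableOn, integral_const_mul]
  have hc0 : ∫ x in Ioi c, (x - (c + a)) * p x = 0 := by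
    rw [hlin_eq, ha]; field_simp; ring
  set k := p (d + a) / p (c + a) with hk
  have hle : ∫ x in Ioi d, (x - (d + a)) * p x ≤ ∫ x in Ioi c, k * ((x - (c + a)) * p x) := by
    rw [hshift]
    refine integral_mono (((hlin (d + a)).comp_add_right (d - c)).integrableOn)
      ((hlin _).const_mul k).integrableOn fun x ↦ ?_
    have hq := hpos (c + a)
    have hdc : 0 ≤ d - c := sub_nonneg.2 hcd
    rcases le_total x (c + a) with hx | hx
    · have h := mul_le_mul_of_log_concave hpos hlogconcave x (sub_nonneg.2 hx) hdc
      rw [show x + (c + a - x) + (d - c) = d + a by ring,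
        show x + (c + a - x) = c + a by ring] at h
      have h' : k * p x ≤ p (x + (d - c)) := by
        rw [hk, div_mul_eq_mul_div, div_le_iff₀ hq]; linarith
      dsimp only
      nlinarith [mul_nonneg (sub_nonneg.2 hx) (sub_nonneg.2 h')]
    · have h := mul_le_mul_of_log_concave hpos hlogconcave (c + a) (sub_nonneg.2 hx) hdc
      rw [show c + a + (x - (c + a)) + (d - c) = x + (d - c) by ring,
        show c + a + (x - (c + a)) = x by ring, show c + a + (d - c) = d + a by ring] at h
      have h' : p (x + (d - c)) ≤ k * p x := by
        rw [hk, div_mul_eq_mul_div, le_div_iff₀ hq]; linarith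
      dsimp only
      nlinarith [mul_nonneg (sub_nonneg.2 hx) (sub_nonneg.2 h')]
  rw [integral_const_mul, hc0, mul_zero, hlin_eq] at hle
  have : (∫ x in Ioi d, x * p x) / (∫ x in Ioi d, p x) ≤ d + a := by
    rw [div_le_iff₀ hSd]; linarith
  dsimp only
  linarith

/-- The supporting-line inequality expressing that the truncated variance is a convex function
of the tail probability. -/
lemma truncated_variance_supporting_line {p : ℝ → ℝ} (hpos : ∀ x, 0 < p x)
    (hlogconcave : ∀ x y θ : ℝ, 0 ≤ θ → θ ≤ 1 →
      p x ^ θ * p y ^ (1 - θ) ≤ p (θ * x + (1 - θ) * y))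
    (hcont : ContinuousOn p (Ioi 0))
    (hp : Integrable p) (hxp : Integrable fun x ↦ x * p x)
    (hmom2 : Integrable fun x ↦ x ^ 2 * p x)
    {V : ℝ → ℝ} (hV : ∀ γ, V γ = (∫ x in Ioi γ, x ^ 2 * p x) -
      (∫ x in Ioi γ, x * p x) ^ 2 / (∫ x in Ioi γ, p x))
    {c γ : ℝ} (hc : 0 ≤ c) (hγ : 0 ≤ γ) :
    V c + ((∫ x in Ioi c, x * p x) / (∫ x in Ioi c, p x) - c) ^ 2 *
      ((∫ x in Ioi γ, p x) - ∫ x in Ioi c, p x) ≤ V γ := by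
  have hanti := mean_residual_antitone hpos hlogconcave hp hxp
  set e : ℝ → ℝ := fun c ↦ (∫ x in Ioi c, x * p x) / (∫ x in Ioi c, p x) - c with he
  have he0 : ∀ t, 0 ≤ e t := fun t ↦ by
    have hS := setIntegral_Ioi_pos hpos hp t
    rw [he, sub_nonneg, le_div_iff₀ hS, ← integral_const_mul]
    exact setIntegral_mono_on (hp.const_mul t).integrableOn hxp.integrableOn measurableSet_Ioi
      fun x hx ↦ mul_le_mul_of_nonneg_right (le_of_lt hx) (hpos x).le
  change V c + e c ^ 2 * _ ≤ _
  set g : ℝ → ℝ := fun t ↦ V t - e c ^ 2 * ∫ x in Ioi t, p x with hg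
  have hSne : ∀ t, (∫ x in Ioi t, p x) ≠ 0 := fun t ↦ (setIntegral_Ioi_pos hpos hp t).ne'
  have hgc : Continuous g := by
    simp_rw [hg, hV]
    exact ((continuous_setIntegral_Ioi hmom2).sub
      (((continuous_setIntegral_Ioi hxp).pow 2).div (continuous_setIntegral_Ioi hp) hSne)).sub
      (continuous_const.mul (continuous_setIntegral_Ioi hp))
  have hgd : ∀ t, 0 < t → HasDerivAt g (p t * (e c ^ 2 - e t ^ 2)) t := fun t ht ↦ by
    have hpt : ContinuousAt p t := hcont.continuousAt (Ioi_mem_nhds ht)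
    simp_rw [hg, hV]
    have h := ((hasDerivAt_setIntegral_Ioi hmom2 ((continuousAt_id.pow 2).mul hpt)).sub
      (((hasDerivAt_setIntegral_Ioi hxp (continuousAt_id.mul hpt)).pow 2).div
        (hasDerivAt_setIntegral_Ioi hp hpt) (hSne t))).sub
      ((hasDerivAt_setIntegral_Ioi hp hpt).const_mul (e c ^ 2))
    refine h.congr_deriv ?_
    have := hSne t
    simp only [he, Pi.pow_apply]
    field_simp
    ring
  have hgoal : g c ≤ g γ := by
    rcases le_total γ c with h | h
    · refine antitoneOn_of_deriv_nonpos (convex_Icc 0 c) hgc.continuousOn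
        (fun t ht ↦ ?_) (fun t ht ↦ ?_) ⟨hγ, h⟩ ⟨hc, le_rfl⟩ h
      all_goals rw [interior_Icc] at ht
      · exact (hgd t ht.1).differentiableAt.differentiableWithinAt
      · rw [(hgd t ht.1).deriv]
        exact mul_nonpos_of_nonneg_of_nonpos (hpos t).le
          (sub_nonpos.2 (pow_le_pow_left₀ (he0 c) (hanti ht.2.le) 2))
    · refine monotoneOn_of_deriv_nonneg (convex_Ici c) hgc.continuousOn
        (fun t ht ↦ ?_) (fun t ht ↦ ?_) self_mem_Ici h h
      all_goals
        rw [interior_Ici] at ht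
        have ht0 : 0 < t := hc.trans_lt ht
      · exact (hgd t ht0).differentiableAt.differentiableWithinAt
      · rw [(hgd t ht0).deriv]
        exact mul_nonneg (hpos t).le
          (sub_nonneg.2 (pow_le_pow_left₀ (he0 t) (hanti (le_of_lt ht)) 2))
  simp only [hg] at hgoal
  linarith

/-- Core minimization in the proof of Proposition 1: among all pairs of
nonnegative thresholds whose tail probabilities sum to s, the symmetric pair
minimizes the sum of the truncated variance terms. -/
theorem stmt12
    (p : ℝ → ℝ)
    (hmeas : Measurable p)
    (hnonneg : ∀ x, 0 ≤ p x)
    (hint : (∫ x, p x) = 1)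
    (heven : ∀ x, p (-x) = p x)
    (hpos : ∀ x, 0 < p x)
    (hlogconcave : ∀ x y θ : ℝ, 0 ≤ θ → θ ≤ 1 →
      p x ^ θ * p y ^ (1 - θ) ≤ p (θ * x + (1 - θ) * y))
    (hC1 : ContDiffOn ℝ 1 p (Ioi 0))
    (hmom2 : Integrable (fun x => x ^ 2 * p x))
    (V : ℝ → ℝ)
    (hV : ∀ γ, V γ = (∫ x in Ioi γ, x ^ 2 * p x) -
      (∫ x in Ioi γ, x * p x) ^ 2 / (∫ x in Ioi γ, p x))
    (s : ℝ) (hs0 : 0 < s) (hs1 : s < 1)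
    (γstar : ℝ) (hγstar : 0 ≤ γstar)
    (hsym : 2 * (∫ x in Ioi γstar, p x) = s) :
    ∀ γ₁ γ₂ : ℝ, 0 ≤ γ₁ → 0 ≤ γ₂ →
      (∫ x in Ioi γ₁, p x) + (∫ x in Ioi γ₂, p x) = s →
      V γstar + V γstar ≤ V γ₁ + V γ₂ := by
  have hp : Integrable p := by
    by_contra h
    simp [integral_undef h] at hint
  have hxp : Integrable fun x ↦ x * p x := by
    refine (hp.add hmom2).mono (measurable_id.mul hmeas).aestronglyMeasurable
      (Filter.Eventually.of_forall fun x ↦ ?_)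
    have h0 := hnonneg x
    have h2 : 0 ≤ p x + x ^ 2 * p x := by positivity
    rw [Pi.add_apply, Real.norm_of_nonneg h2, norm_mul, Real.norm_eq_abs,
      Real.norm_of_nonneg h0, ← sq_abs x]
    nlinarith [mul_nonneg (sq_nonneg (|x| - 1)) h0, mul_nonneg (sq_nonneg |x|) h0]
  intro γ₁ γ₂ h₁ h₂ hsum
  have hline := fun γ (hγ : 0 ≤ γ) ↦ truncated_variance_supporting_line hpos hlogconcave
    hC1.continuousOn hp hxp hmom2 hV hγstar hγ
  have key₁ := hline γ₁ h₁
  have key₂ := hline γ₂ h₂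
  have hS : ∫ x in Ioi γ₂, p x = 2 * (∫ x in Ioi γstar, p x) - ∫ x in Ioi γ₁, p x := by
    linarith
  rw [hS] at key₂
  linarith
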